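/- Let N ≥ 2, let α = (α_1,…,α_N) ∈ (0,∞)^N, and fix j_0 ∈ {1,…,N}. Identify the open unit simplex with Δ = {w ∈ ℝ^{N−1} : w_i > 0 for all i, Σ_i w_i < 1}, and for w ∈ Δ write y(w) = (w_1,…,w_{N−1}, 1 − Σ_i w_i) ∈ (0,1)^N. Let m be the probability measure on Δ obtained by normalizing the measure with Lebesgue density w ↦ y(w)_{j_0} · Π_{j=1}^N y(w)_j^{α_j − 1} (the Dirichlet(α) density size-biased by the j_0-th coordinate). Let G_1,…,G_N be independent random variables with G_{j_0} Gamma-distributed with shape α_{j_0} + 1 and rate 1, and G_j Gamma-distributed with shape α_j and rate 1 for j ≠ j_0. Then the pushforward of m under the map w ↦ (y(w)_1/y(w)_{j_0}, …, y(w)_N/y(w)_{j_0}) equals the law of the random vector (G_1/G_{j_0}, …, G_N/G_{j_0}). -/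

import Mathlib

open MeasureTheory ProbabilityTheory Real Set
open scoped ENNReal

namespace DirAux

lemma lintegral_pi_prod : ∀ (n : ℕ) (f : Fin n → ℝ → ℝ≥0∞) (_ : ∀ i, Measurable (f i)),
    ∫⁻ x : Fin n → ℝ, ∏ i, f i (x i) = ∏ i, ∫⁻ x, f i x
  | 0, f, _ => by
    simp [MeasureTheory.Measure.volume_pi_eq_dirac 0]
  | n + 1, f, hf => by
    have h := volume_preserving_piFinSuccAbove (fun _ : Fin (n + 1) => ℝ) 0
    rw [← h.symm.lintegral_comp_emb (MeasurableEquiv.measurableEmbedding _)]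
    rw [Fin.prod_univ_succ, ← lintegral_pi_prod n (fun i => f i.succ) (fun i => hf _)]
    rw [Measure.volume_eq_prod, ← lintegral_prod_mul (hf 0).aemeasurable (by
      apply Measurable.aemeasurable
      exact Finset.measurable_prod _ fun i _ => (hf _).comp (measurable_pi_apply i))]
    refine lintegral_congr fun z => ?_
    rw [Fin.prod_univ_succ]
    simp [MeasurableEquiv.piFinSuccAbove, Fin.insertNthEquiv]

lemma pi_withDensity (n : ℕ) (f : Fin n → ℝ → ℝ≥0∞) (hf : ∀ i, Measurable (f i))
    [∀ i, SigmaFinite ((volume : Measure ℝ).withDensity (f i))] :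
    Measure.pi (fun i => (volume : Measure ℝ).withDensity (f i))
      = (volume : Measure (Fin n → ℝ)).withDensity (fun x => ∏ i, f i (x i)) := by
  apply Measure.pi_eq
  intro s hs
  rw [withDensity_apply _ (MeasurableSet.univ_pi hs)]
  rw [← lintegral_indicator (MeasurableSet.univ_pi hs)]
  simp_rw [withDensity_apply _ (hs _), ← lintegral_indicator (hs _)]
  rw [← lintegral_pi_prod n _ (fun i => (hf i).indicator (hs i))]
  refine lintegral_congr fun x => ?_
  by_cases hx : x ∈ Set.univ.pi s
  · rw [indicator_of_mem hx]
    refine Finset.prod_congr rfl fun i _ => ?_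
    rw [indicator_of_mem (hx i (mem_univ i))]
  · rw [indicator_of_notMem hx]
    have : ∃ i, x i ∉ s i := by simpa [Set.mem_pi] using hx
    obtain ⟨i, hi⟩ := this
    exact (Finset.prod_eq_zero (Finset.mem_univ i) (indicator_of_notMem hi _)).symm

/-- the point of the hyperplane -/
def yy (n : ℕ) (w : Fin n → ℝ) : Fin (n + 1) → ℝ := Fin.snoc w (1 - ∑ i, w i)

lemma measurable_snoc (n : ℕ) :
    Measurable (fun z : ℝ × (Fin n → ℝ) => (Fin.snoc z.2 z.1 : Fin (n + 1) → ℝ)) := by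
  refine measurable_pi_iff.2 fun j => ?_
  refine Fin.lastCases ?_ (fun i => ?_) j
  · simpa using measurable_fst
  · simp only [Fin.snoc_castSucc]; fun_prop

lemma measurable_yy (n : ℕ) : Measurable (yy n) := by
  have : yy n = (fun z : ℝ × (Fin n → ℝ) => (Fin.snoc z.2 z.1 : Fin (n + 1) → ℝ)) ∘
    (fun w => (1 - ∑ i, w i, w)) := rfl
  rw [this]
  refine (measurable_snoc n).comp ?_
  fun_prop

lemma sum_yy (n : ℕ) (w : Fin n → ℝ) : ∑ j, yy n w j = 1 := by
  rw [Fin.sum_univ_castSucc]; simp [yy]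

lemma lintegral_smul_vol (n : ℕ) (F : (Fin n → ℝ) → ℝ≥0∞) (s : ℝ) (hs : s ≠ 0) :
    ∫⁻ x, F x = ENNReal.ofReal (|s| ^ n) * ∫⁻ w, F (s • w) := by
  have h := Measure.map_addHaar_smul (volume : Measure (Fin n → ℝ)) hs
  have h2 : ∫⁻ w, F (s • w) = ∫⁻ x, F x ∂(Measure.map (s • ·) volume) :=
    ((Homeomorph.smulOfNeZero s hs).measurableEmbedding.lintegral_map F).symm
  rw [h2, h, lintegral_smul_measure, smul_eq_mul, ← mul_assoc, ← ENNReal.ofReal_mul (by positivity)]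
  rw [Module.finrank_fin_fun, abs_inv, abs_pow, mul_inv_cancel₀ (by positivity)]
  simp

lemma change (n : ℕ) (H : (Fin (n + 1) → ℝ) → ℝ≥0∞) (hH : Measurable H) :
    ∫⁻ g, H g = ∫⁻ s : ℝ, ENNReal.ofReal (|s| ^ n) * ∫⁻ w, H (s • yy n w) := by
  have h := volume_preserving_piFinSuccAbove (fun _ : Fin (n + 1) => ℝ) (Fin.last n)
  rw [← h.symm.lintegral_comp_emb (MeasurableEquiv.measurableEmbedding _)]
  have e : ∀ z, H ((MeasurableEquiv.piFinSuccAbove (fun _ : Fin (n + 1) => ℝ) (Fin.last n)).symm z)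
      = H (Fin.snoc z.2 z.1) := by
    intro z
    simp [MeasurableEquiv.piFinSuccAbove, Fin.insertNthEquiv]
  simp_rw [e]
  have hm : Measurable (fun z : ℝ × (Fin n → ℝ) => H (Fin.snoc z.2 z.1)) :=
    hH.comp (measurable_snoc n)
  rw [Measure.volume_eq_prod, lintegral_prod_symm' _ hm]
  have e2 : ∀ x : Fin n → ℝ, ∫⁻ t : ℝ, H (Fin.snoc x t) = ∫⁻ s : ℝ, H (Fin.snoc x (s - ∑ i, x i)) :=
    fun x => (lintegral_sub_right_eq_self (fun t => H (Fin.snoc x t)) (∑ i, x i)).symm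
  simp_rw [e2]
  rw [lintegral_lintegral_swap]
  · refine lintegral_congr_ae ?_
    filter_upwards [Measure.ae_ne volume (0 : ℝ)] with s hs
    rw [lintegral_smul_vol n _ s hs]
    congr 1
    refine lintegral_congr fun w => ?_
    congr 1
    ext j
    refine Fin.lastCases ?_ (fun i => ?_) j
    · simp [yy, mul_sub, Finset.mul_sum]
    · simp [yy]
  · apply Measurable.aemeasurable
    have : Measurable (fun z : (Fin n → ℝ) × ℝ => (z.2 - ∑ i, z.1 i, z.1)) := by fun_prop
    exact hm.comp this

/-- gamma density supported on the open half line -/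
noncomputable def pp (a x : ℝ) : ℝ≥0∞ :=
  if 0 < x then ENNReal.ofReal ((1 / Gamma a) * x ^ (a - 1) * exp (-x)) else 0

lemma measurable_pp (a : ℝ) : Measurable (pp a) := by
  unfold pp
  exact Measurable.ite measurableSet_Ioi (by fun_prop) measurable_const

lemma gamma_eq (a : ℝ) : gammaMeasure a 1 = volume.withDensity (pp a) := by
  unfold gammaMeasure
  apply withDensity_congr_ae
  filter_upwards [Measure.ae_ne volume (0 : ℝ)] with x hx
  rcases lt_or_gt_of_ne hx with h | h
  · rw [gammaPDF_of_neg h, pp, if_neg (not_lt.2 h.le)]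
  · rw [gammaPDF_of_nonneg h.le, pp, if_pos h]; simp

/-- the simplex -/
def DD (n : ℕ) : Set (Fin n → ℝ) := {w | (∀ i, 0 < w i) ∧ ∑ i, w i < 1}

lemma mem_DD (n : ℕ) (w : Fin n → ℝ) : w ∈ DD n ↔ ∀ j, 0 < yy n w j := by
  rw [Fin.forall_fin_succ']
  simp [DD, yy]

lemma measurableSet_DD (n : ℕ) : MeasurableSet (DD n) := by
  have : DD n = ⋂ j, {w | 0 < yy n w j} := by ext w; simp [mem_DD]
  rw [this]
  exact MeasurableSet.iInter fun j =>
    measurableSet_lt measurable_const ((measurable_pi_apply j).comp (measurable_yy n))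

/-- radial factor -/
noncomputable def KK (n : ℕ) (a : Fin (n + 1) → ℝ) (s : ℝ) : ℝ≥0∞ :=
  if 0 < s then ENNReal.ofReal ((∏ j, ((1 / Gamma (a j)) * s ^ (a j - 1))) * exp (-s)) else 0

lemma prod_pp (n : ℕ) (a : Fin (n + 1) → ℝ) (ha : ∀ j, 0 < a j) (s : ℝ) (w : Fin n → ℝ) :
    ∏ j, pp (a j) ((s • yy n w) j) =
      KK n a s * (DD n).indicator (fun w => ENNReal.ofReal (∏ j, yy n w j ^ (a j - 1))) w := by
  by_cases hs : 0 < s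
  · by_cases hw : w ∈ DD n
    · rw [indicator_of_mem hw]
      rw [mem_DD] at hw
      have hG := fun j => Gamma_pos_of_pos (ha j)
      have hsy : ∀ j, 0 < (s • yy n w) j := fun j => mul_pos hs (hw j)
      rw [KK, if_pos hs, ← ENNReal.ofReal_mul (by
        have : 0 ≤ ∏ j, ((1 / Gamma (a j)) * s ^ (a j - 1)) :=
          Finset.prod_nonneg fun j _ => by have := hG j; positivity
        positivity)]
      simp_rw [pp, if_pos (hsy _)]
      rw [← ENNReal.ofReal_prod_of_nonneg (fun j _ => by have := hG j; have := hsy j; positivity)]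
      congr 1
      rw [Finset.prod_mul_distrib, ← Real.exp_sum]
      have : ∑ j, -((s • yy n w) j) = -s := by
        simp [← Finset.mul_sum, sum_yy]
      rw [this, mul_right_comm, ← Finset.prod_mul_distrib]
      congr 1
      refine Finset.prod_congr rfl fun j _ => ?_
      rw [Pi.smul_apply, smul_eq_mul, mul_rpow hs.le (hw j).le]
      ring
    · rw [indicator_of_notMem hw, mul_zero]
      rw [mem_DD] at hw
      push Not at hw
      obtain ⟨j, hj⟩ := hw
      refine Finset.prod_eq_zero (Finset.mem_univ j) ?_
      rw [pp, if_neg]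
      rw [not_lt]
      exact mul_nonpos_of_nonneg_of_nonpos hs.le hj
  · rw [KK, if_neg hs, zero_mul]
    by_contra hne
    apply hs
    have hp : ∀ j, 0 < (s • yy n w) j := by
      intro j
      by_contra hj
      exact hne (Finset.prod_eq_zero (Finset.mem_univ j) (by rw [pp, if_neg hj]))
    have := Finset.sum_pos (fun j _ => hp j) (Finset.univ_nonempty (α := Fin (n + 1)))
    simpa [← Finset.mul_sum, sum_yy] using this

/-- coordinate ratios -/
noncomputable def rr (n : ℕ) (j₀ : Fin (n + 1)) (g : Fin (n + 1) → ℝ) : Fin (n + 1) → ℝ :=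
  fun j => g j / g j₀

lemma measurable_rr (n : ℕ) (j₀ : Fin (n + 1)) : Measurable (rr n j₀) := by
  unfold rr; fun_prop

lemma key (n : ℕ) (a : Fin (n + 1) → ℝ) (ha : ∀ j, 0 < a j) (j₀ : Fin (n + 1))
    (A : Set (Fin (n + 1) → ℝ)) (hA : MeasurableSet A) :
    Measure.map (rr n j₀) (Measure.pi (fun j => gammaMeasure (a j) 1)) A =
      (∫⁻ s : ℝ, ENNReal.ofReal (|s| ^ n) * KK n a s) *
      Measure.map (fun w => rr n j₀ (yy n w)) ((volume.restrict (DD n)).withDensity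
        (fun w => ENNReal.ofReal (∏ j, yy n w j ^ (a j - 1)))) A := by
  have hmr := measurable_rr n j₀
  have hmy := measurable_yy n
  have hmc : Measurable (fun w => rr n j₀ (yy n w)) := hmr.comp hmy
  rw [Measure.map_apply hmr hA, Measure.map_apply hmc hA]
  have : ∀ j, SigmaFinite ((volume : Measure ℝ).withDensity (pp (a j))) := fun j => by
    rw [← gamma_eq]
    have := isProbabilityMeasure_gammaMeasure (ha j) one_pos
    infer_instance
  simp_rw [gamma_eq]
  have hB := hmr hA
  have hC : MeasurableSet ((fun w => rr n j₀ (yy n w)) ⁻¹' A) := (hmr.comp hmy) hA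
  have hD := measurableSet_DD n
  have hmp : Measurable fun x : Fin (n + 1) → ℝ => ∏ i, pp (a i) (x i) :=
    Finset.measurable_prod _ fun i _ => (measurable_pp _).comp (measurable_pi_apply i)
  have hmd : Measurable fun w => ENNReal.ofReal (∏ j, yy n w j ^ (a j - 1)) := by
    apply Measurable.ennreal_ofReal
    exact Finset.measurable_prod _ fun i _ => ((measurable_pi_apply i).comp hmy).pow_const _
  rw [pi_withDensity _ _ (fun j => measurable_pp (a j)), withDensity_apply _ hB,
    withDensity_apply _ hC, ← lintegral_indicator hB, change _ _ (hmp.indicator hB),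
    Measure.restrict_restrict hC, ← lintegral_indicator (hC.inter hD)]
  have hfin : ∀ s, KK n a s ≠ ∞ := fun s => by unfold KK; split_ifs <;> simp
  have e : ∀ s w, (rr n j₀ ⁻¹' A).indicator (fun x => ∏ i, pp (a i) (x i)) (s • yy n w) =
      KK n a s * (((fun w => rr n j₀ (yy n w)) ⁻¹' A) ∩ DD n).indicator
        (fun w => ENNReal.ofReal (∏ j, yy n w j ^ (a j - 1))) w := by
    intro s w
    rw [← indicator_indicator]
    by_cases hs : s = 0
    · have h0 : KK n a s = 0 := by simp [KK, hs]
      rw [h0, zero_mul]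
      apply indicator_apply_eq_zero.2
      intro _
      rw [prod_pp n a ha, h0, zero_mul]
    · have hr : rr n j₀ (s • yy n w) = rr n j₀ (yy n w) := by
        ext j
        simp [rr, mul_div_mul_left _ _ hs]
      by_cases hw : rr n j₀ (yy n w) ∈ A
      · rw [indicator_of_mem (by simpa [hr] using hw), indicator_of_mem (by simpa using hw),
          prod_pp n a ha]
      · rw [indicator_of_notMem (by simpa [hr] using hw), indicator_of_notMem (by simpa using hw),
          mul_zero]
  simp_rw [e]
  simp_rw [lintegral_const_mul' _ _ (hfin _), ← mul_assoc]
  rw [lintegral_mul_const]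
  have : Measurable (KK n a) := by
    unfold KK
    exact Measurable.ite measurableSet_Ioi (by fun_prop) measurable_const
  fun_prop

end DirAux

/-- Proposition 11, Dirichlet mixture model: the pushforward of the
size-biased Dirichlet(α) distribution (normalized density `y_{j₀} Π_j y_j^{α_j−1}` on
the open unit simplex, in the coordinates `w ↦ y(w) = (w, 1 − Σ w_i)`) under
`y ↦ (y_j / y_{j₀})_j` equals the law of `(G_j / G_{j₀})_j` for independent Gamma
variables with `G_{j₀} ~ Gamma(α_{j₀} + 1, 1)` and `G_j ~ Gamma(α_j, 1)` for `j ≠ j₀`.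
Here the dimension is `N = n + 1 ≥ 2`. -/
theorem dirichlet_size_biased_ratio (n : ℕ) (hn : 1 ≤ n)
    (α : Fin (n + 1) → ℝ) (hα : ∀ j, 0 < α j) (j₀ : Fin (n + 1)) :
    let Δ : Set (Fin n → ℝ) := {w | (∀ i, 0 < w i) ∧ ∑ i, w i < 1}
    let y : (Fin n → ℝ) → Fin (n + 1) → ℝ := fun w => Fin.snoc w (1 - ∑ i, w i)
    let m₀ : Measure (Fin n → ℝ) :=
      (volume.restrict Δ).withDensity
        (fun w => ENNReal.ofReal (y w j₀ * ∏ j, y w j ^ (α j - 1)))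
    let m : Measure (Fin n → ℝ) := (m₀ Set.univ)⁻¹ • m₀
    let γ : Measure (Fin (n + 1) → ℝ) :=
      Measure.pi (fun j => gammaMeasure (if j = j₀ then α j + 1 else α j) 1)
    Measure.map (fun w => fun j => y w j / y w j₀) m
      = Measure.map (fun g => fun j => g j / g j₀) γ := by
  intro Δ y m₀ m γ
  set a : Fin (n + 1) → ℝ := fun j => if j = j₀ then α j + 1 else α j with ha_def
  have ha : ∀ j, 0 < a j := by
    intro j
    have := hα j
    simp only [ha_def]
    split_ifs <;> linarith
  have hm₀ : m₀ = (volume.restrict (DirAux.DD n)).withDensity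
      (fun w => ENNReal.ofReal (∏ j, DirAux.yy n w j ^ (a j - 1))) := by
    apply withDensity_congr_ae
    filter_upwards [ae_restrict_mem (DirAux.measurableSet_DD n)] with w hw
    replace hw := (DirAux.mem_DD n w).1 hw
    congr 1
    change DirAux.yy n w j₀ * ∏ j, DirAux.yy n w j ^ (α j - 1) = _
    rw [← Finset.mul_prod_erase _ _ (Finset.mem_univ j₀),
      ← Finset.mul_prod_erase _ (fun j => DirAux.yy n w j ^ (a j - 1)) (Finset.mem_univ j₀),
      ← mul_assoc]
    congr 1
    · rw [← Real.rpow_one_add' (hw j₀).le]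
      · simp [ha_def]
      · have := hα j₀
        linarith
    · refine Finset.prod_congr rfl fun j hj => ?_
      simp [ha_def, Finset.ne_of_mem_erase hj]
  set C := ∫⁻ s : ℝ, ENNReal.ofReal (|s| ^ n) * DirAux.KK n a s with hC
  have key : ∀ A, MeasurableSet A → Measure.map (fun g => fun j => g j / g j₀) γ A =
      C * Measure.map (fun w => fun j => y w j / y w j₀) m₀ A := by
    intro A hA
    rw [hm₀]
    exact DirAux.key n a ha j₀ A hA
  have hmr := DirAux.measurable_rr n j₀
  have hmry : Measurable (fun w => fun j => y w j / y w j₀) := hmr.comp (DirAux.measurable_yy n)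
  have hγ : IsProbabilityMeasure γ := by
    have := fun j => isProbabilityMeasure_gammaMeasure (ha j) one_pos
    change IsProbabilityMeasure (Measure.pi fun j => gammaMeasure (a j) 1)
    infer_instance
  have h1 : 1 = C * m₀ univ := by
    have := key univ MeasurableSet.univ
    rw [Measure.map_apply hmry MeasurableSet.univ] at this
    erw [Measure.map_apply hmr MeasurableSet.univ] at this
    simpa using this
  have hCi : C = (m₀ univ)⁻¹ := ENNReal.eq_inv_of_mul_eq_one_left h1.symm
  ext A hA
  rw [key A hA, hCi, Measure.map_smul]
  rfl
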